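/- Let ρ be a density matrix on H_A ⊗ H_B and let |TFD⟩ be a purification of ρ on (H_A ⊗ H_B) ⊗ (H_A ⊗ H_B). Then the mutual information satisfies I_ρ(A:B) ≤ 2·S(σ), where σ = tr_{B_L B_R}(|TFD⟩⟨TFD|) is the reduced state of the purification on the two copies of A. -/

import Mathlib

open scoped ComplexOrder Kronecker

/-- Von Neumann entropy `S(ρ) = -tr(ρ log ρ)`, computed via the eigenvalues. -/
noncomputable def vnEntropy {n : Type*} [Fintype n] [DecidableEq n]
    (ρ : Matrix n n ℂ) : ℝ :=
  if h : ρ.IsHermitian then -∑ i, h.eigenvalues i * Real.log (h.eigenvalues i) else 0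

/-- Matrix logarithm of a Hermitian matrix, via the functional calculus. -/
noncomputable def mlog {n : Type*} [Fintype n] [DecidableEq n]
    (ρ : Matrix n n ℂ) : Matrix n n ℂ :=
  if h : ρ.IsHermitian then h.cfc Real.log else 0

/-- Quantum relative entropy `D(ρ‖σ) = tr(ρ(log ρ - log σ))`. -/
noncomputable def relEntropy {n : Type*} [Fintype n] [DecidableEq n]
    (ρ σ : Matrix n n ℂ) : ℝ :=
  ((ρ * (mlog ρ - mlog σ)).trace).re

/-- `ρ` is a density matrix: positive semidefinite with unit trace. -/
def IsDensityMatrix {n : Type*} [Fintype n] [DecidableEq n]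
    (ρ : Matrix n n ℂ) : Prop :=
  ρ.PosSemidef ∧ ρ.trace = 1

/-- Reduced density matrix on the first factor (partial trace over `B`). -/
noncomputable def ptraceB {a b : Type*} [Fintype a] [Fintype b]
    (ρ : Matrix (a × b) (a × b) ℂ) : Matrix a a ℂ :=
  Matrix.of fun i i' => ∑ j : b, ρ (i, j) (i', j)

/-- Reduced density matrix on the second factor (partial trace over `A`). -/
noncomputable def ptraceA {a b : Type*} [Fintype a] [Fintype b]
    (ρ : Matrix (a × b) (a × b) ℂ) : Matrix b b ℂ :=
  Matrix.of fun j j' => ∑ i : a, ρ (i, j) (i, j')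

/-- Mutual information `I_ρ(A:B) = S(ρ^A) + S(ρ^B) - S(ρ)`. -/
noncomputable def mutualInfo {a b : Type*} [Fintype a] [Fintype b]
    [DecidableEq a] [DecidableEq b] (ρ : Matrix (a × b) (a × b) ℂ) : ℝ :=
  vnEntropy (ptraceB ρ) + vnEntropy (ptraceA ρ) - vnEntropy ρ

open Matrix Filter Topology in
lemma aux_scalar {ι κ : Type*} [Fintype ι] [Fintype κ] (w r : ι → ℝ) (l : κ → ℝ)
    (hr0 : ∀ x, 0 ≤ r x) (hr : ∀ x, w x ≠ 0 → r x ≠ 0)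
    (hsum : ∑ x, w x = ∑ m, l m)
    (h : ∀ s : ℝ, 0 < s → ∑ x, w x / (r x + s) ≤ ∑ m, l m / (l m ^ 2 + s)) :
    ∑ m, l m * Real.log (l m ^ 2) ≤ ∑ x, w x * Real.log (r x) := by
  set F : ℝ → ℝ := fun s => ∑ x, w x * Real.log (s + r x) - ∑ m, l m * Real.log (s + l m ^ 2)
    with hF
  have hd : ∀ s : ℝ, 0 < s → HasDerivAt F
      (∑ x, w x * (1 / (s + r x)) - ∑ m, l m * (1 / (s + l m ^ 2))) s := by
    intro s hs
    apply HasDerivAt.sub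
    · apply HasDerivAt.fun_sum
      intro x _
      apply HasDerivAt.const_mul
      exact ((hasDerivAt_id s).add_const (r x)).log (by have := hr0 x; simp only [id]; positivity)
    · apply HasDerivAt.fun_sum
      intro x _
      apply HasDerivAt.const_mul
      exact ((hasDerivAt_id s).add_const (l x ^ 2)).log (by simp only [id]; positivity)
  have hanti : AntitoneOn F (Set.Ioi 0) := by
    apply antitoneOn_of_deriv_nonpos (convex_Ioi 0)
    · intro s hs
      exact (hd s hs).continuousAt.continuousWithinAt
    · intro s hs
      rw [interior_Ioi] at hs
      exact (hd s hs).differentiableAt.differentiableWithinAt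
    · intro s hs
      rw [interior_Ioi] at hs
      rw [(hd s hs).deriv]
      have := h s hs
      simp only [mul_one_div, add_comm s]
      linarith
  have hlim : Tendsto F atTop (𝓝 0) := by
    have h1 : Tendsto (fun s => ∑ x, w x * (Real.log (s + r x) - Real.log s)
        - ∑ m, l m * (Real.log (s + l m ^ 2) - Real.log s)) atTop
        (𝓝 (∑ x, w x * 0 - ∑ m, l m * 0)) := by
      apply Tendsto.sub
      · exact tendsto_finsetSum _ fun x _ => (Real.tendsto_log_comp_add_sub_log (r x)).const_mul _
      · exact tendsto_finsetSum _ fun x _ =>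
          (Real.tendsto_log_comp_add_sub_log (l x ^ 2)).const_mul _
    simp only [mul_zero, Finset.sum_const_zero, sub_zero] at h1
    refine h1.congr fun s => ?_
    simp only [hF, mul_sub, Finset.sum_sub_distrib, ← Finset.sum_mul, hsum]
    ring
  have hpos : ∀ s : ℝ, 0 < s → 0 ≤ F s := by
    intro s hs
    refine le_of_tendsto hlim ?_
    filter_upwards [eventually_ge_atTop s] with t ht
    exact hanti hs (lt_of_lt_of_le hs ht) ht
  have hz : ∀ c y : ℝ, (c ≠ 0 → y ≠ 0) →
      Tendsto (fun s => c * Real.log (s + y)) (𝓝[>] 0) (𝓝 (c * Real.log y)) := by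
    intro c y hy
    by_cases hc : c = 0
    · simp [hc]
    · have : ContinuousAt (fun s : ℝ => c * Real.log (s + y)) 0 := by
        apply ContinuousAt.mul continuousAt_const
        apply ContinuousAt.log (by fun_prop)
        simpa using hy hc
      have h2 := this.tendsto.mono_left (nhdsWithin_le_nhds (s := Set.Ioi 0))
      simpa using h2
  have hlim0 : Tendsto F (𝓝[>] 0)
      (𝓝 (∑ x, w x * Real.log (r x) - ∑ m, l m * Real.log (l m ^ 2))) := by
    apply Tendsto.sub
    · exact tendsto_finsetSum _ fun x _ => hz _ _ (hr x)
    · exact tendsto_finsetSum _ fun x _ => hz _ _ (fun hh => by positivity)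
  have := ge_of_tendsto hlim0 (by
    filter_upwards [self_mem_nhdsWithin] with s hs using hpos s hs)
  linarith

open Matrix in
lemma aux_tr_nonneg {m n : Type*} [Fintype m] [Fintype n] (X : Matrix m n ℂ) :
    0 ≤ (Xᴴ * X).trace.re := by
  simp only [Matrix.trace, Matrix.diag, Matrix.mul_apply, Matrix.conjTranspose_apply,
    Complex.re_sum]
  refine Finset.sum_nonneg fun i _ => Finset.sum_nonneg fun j _ => ?_
  simp only [Complex.star_def, ← Complex.normSq_eq_conj_mul_self, Complex.ofReal_re]
  exact Complex.normSq_nonneg _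

open Matrix in
lemma aux_tr_normSq {m n : Type*} [Fintype m] [Fintype n] (X : Matrix m n ℂ) :
    (Xᴴ * X).trace.re = ∑ i, ∑ j, Complex.normSq (X i j) := by
  simp only [Matrix.trace, Matrix.diag, Matrix.mul_apply, Matrix.conjTranspose_apply,
    Complex.re_sum]
  rw [Finset.sum_comm]
  simp only [Complex.star_def, ← Complex.normSq_eq_conj_mul_self, Complex.ofReal_re]

open Matrix in
/-- completing the square -/
lemma aux_square {m n : Type*} [Fintype m] [Fintype n] [DecidableEq m] [DecidableEq n]
    (M X : Matrix m n ℂ) (W : Matrix m m ℂ) (hW : Wᴴ = W) (s : ℝ) (hs : 0 < s)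
    (hWs : (M * Mᴴ) * W * (M * Mᴴ) + (s : ℂ) • W = 1) :
    2 * (Mᴴ * X).trace.re - ((Mᴴ * X * Mᴴ)ᴴ * (Mᴴ * X * Mᴴ)).trace.re - s * (Xᴴ * X).trace.re
      ≤ (W * (M * Mᴴ)).trace.re := by
  set B : Matrix m n ℂ → Matrix m n ℂ → ℂ := fun P Q =>
    ((Mᴴ * P * Mᴴ)ᴴ * (Mᴴ * Q * Mᴴ)).trace + (s : ℂ) * (Pᴴ * Q).trace with hB
  have hB0 : ∀ Z, B (W * M) Z = (Mᴴ * Z).trace := by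
    intro Z
    have h1 : ((Mᴴ * (W * M) * Mᴴ)ᴴ * (Mᴴ * Z * Mᴴ)).trace
        = (Mᴴ * ((M * Mᴴ) * W * (M * Mᴴ)) * Z).trace := by
      rw [← Matrix.mul_assoc _ _ Mᴴ, Matrix.trace_mul_comm _ Mᴴ]
      simp only [conjTranspose_mul, conjTranspose_conjTranspose, hW, Matrix.mul_assoc]
    have h2 : (s : ℂ) * ((W * M)ᴴ * Z).trace = (Mᴴ * ((s : ℂ) • W) * Z).trace := by
      simp [conjTranspose_mul, hW, Matrix.trace_smul]
    simp only [hB]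
    rw [h1, h2, ← trace_add, ← Matrix.add_mul, ← Matrix.mul_add, hWs, Matrix.mul_one]
  have hconj : ∀ P Q, (B P Q).re = (B Q P).re := by
    intro P Q
    have : B P Q = star (B Q P) := by
      simp only [hB, star_add, star_mul', ← trace_conjTranspose, conjTranspose_mul,
        conjTranspose_conjTranspose]
      simp
    rw [this]; simp
  have hexp : (B (X - W * M) (X - W * M)) =
      B X X - B X (W * M) - B (W * M) X + B (W * M) (W * M) := by
    simp only [hB, Matrix.mul_sub, Matrix.sub_mul, conjTranspose_sub, trace_sub]
    ring
  have hnn : 0 ≤ (B (X - W * M) (X - W * M)).re := by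
    simp only [hB, Complex.add_re, Complex.re_ofReal_mul]
    have h1 := aux_tr_nonneg (Mᴴ * (X - W * M) * Mᴴ)
    have h2 := aux_tr_nonneg (X - W * M)
    positivity
  rw [hexp] at hnn
  simp only [Complex.add_re, Complex.sub_re] at hnn
  rw [hconj X (W * M), hB0, hB0] at hnn
  have h3 : (Mᴴ * (W * M)).trace = (W * (M * Mᴴ)).trace := by
    rw [Matrix.trace_mul_comm, Matrix.mul_assoc]
  rw [h3] at hnn
  simp only [hB, Complex.add_re, Complex.re_ofReal_mul] at hnn
  linarith

open Matrix in
/-- the resolvent -/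
lemma aux_resolvent {m : Type*} [Fintype m] [DecidableEq m] (σ : Matrix m m ℂ)
    (h : σ.IsHermitian) (s : ℝ) (hs : 0 < s) :
    ∃ W : Matrix m m ℂ, Wᴴ = W ∧ σ * W * σ + (s : ℂ) • W = 1 ∧
      (W * σ).trace.re = ∑ i, h.eigenvalues i / (h.eigenvalues i ^ 2 + s) := by
  set E : Matrix m m ℂ := (h.eigenvectorUnitary : Matrix m m ℂ) with hE
  have hEE : Eᴴ * E = 1 := by
    have := (h.eigenvectorUnitary).2
    exact (Matrix.mem_unitaryGroup_iff'.mp this)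
  have hEE' : E * Eᴴ = 1 := by
    have := (h.eigenvectorUnitary).2
    exact (Matrix.mem_unitaryGroup_iff.mp this)
  set L : m → ℂ := fun i => (h.eigenvalues i : ℂ) with hL
  have hσ : σ = E * diagonal L * Eᴴ := by
    have := h.spectral_theorem
    rw [Unitary.conjStarAlgAut_apply] at this
    exact this
  set g : m → ℂ := fun i => ((1 / (h.eigenvalues i ^ 2 + s) : ℝ) : ℂ) with hg
  have key : ∀ (x y : m → ℂ), (E * diagonal x * Eᴴ) * (E * diagonal y * Eᴴ)
      = E * diagonal (fun i => x i * y i) * Eᴴ := by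
    intro x y
    rw [← diagonal_mul_diagonal]
    calc _ = E * diagonal x * (Eᴴ * E) * diagonal y * Eᴴ := by simp only [Matrix.mul_assoc]
      _ = _ := by rw [hEE]; simp only [Matrix.mul_assoc, Matrix.mul_one]
  refine ⟨E * diagonal g * Eᴴ, ?_, ?_, ?_⟩
  · simp only [conjTranspose_mul, conjTranspose_conjTranspose, diagonal_conjTranspose,
      Matrix.mul_assoc]
    congr 3
    ext i
    simp [hg]
  · rw [hσ, key, key]
    have : (s : ℂ) • (E * diagonal g * Eᴴ) = E * diagonal (fun i => s * g i) * Eᴴ := by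
      have : diagonal (fun i => (s : ℂ) * g i) = (s : ℂ) • diagonal g := by
        rw [← diagonal_smul]; rfl
      rw [this]; simp
    rw [this, ← Matrix.add_mul, ← Matrix.mul_add, diagonal_add]
    have : (fun i => L i * g i * L i + s * g i) = fun _ => 1 := by
      ext i
      simp only [hL, hg]
      norm_cast
      have : h.eigenvalues i ^ 2 + s ≠ 0 := by positivity
      field_simp
    rw [this, diagonal_one, Matrix.mul_one, hEE']
  · conv_lhs => rw [hσ, key, Matrix.trace_mul_comm, ← Matrix.mul_assoc, hEE, Matrix.one_mul,
      trace_diagonal]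
    simp only [hL, hg, Complex.re_sum]
    refine Finset.sum_congr rfl fun i _ => ?_
    norm_cast
    ring

lemma aux_cauchy {ι : Type*} [Fintype ι] (f g : ι → ℂ) :
    Complex.normSq (∑ x, f x * g x) ≤ (∑ x, Complex.normSq (f x)) * ∑ x, Complex.normSq (g x) := by
  simp only [Complex.normSq_eq_norm_sq]
  calc ‖∑ x, f x * g x‖ ^ 2 ≤ (∑ x, ‖f x‖ * ‖g x‖) ^ 2 := by
        gcongr
        refine (norm_sum_le _ _).trans (le_of_eq ?_)
        simp
    _ ≤ _ := Finset.sum_mul_sq_le_sq_mul_sq _ _ _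

open Matrix in
lemma aux_opt {n : Type*} [Fintype n] [DecidableEq n] (U F : Matrix n n ℂ)
    (hU : Uᴴ * U = 1) (hF : Fᴴ * F = 1) (p q : n → ℝ) (hp : ∀ i, 0 ≤ p i) (hq : ∀ i, 0 ≤ q i)
    (s : ℝ) (hs : 0 < s) :
    ∃ Y : Matrix n n ℂ,
      2 * (U * diagonal (fun i => (p i : ℂ)) * Uᴴ * Y).trace.re
      - (Yᴴ * (F * diagonal (fun i => (q i : ℂ)) * Fᴴ) * Y).trace.re
      - s * (Y * (U * diagonal (fun i => (p i : ℂ)) * Uᴴ) * Yᴴ).trace.re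
      = ∑ i, ∑ k, p i ^ 2 * Complex.normSq ((Uᴴ * F) i k) / (q k + s * p i) := by
  set T := Uᴴ * F with hT
  set C : Matrix n n ℂ := fun k i => star (T i k) * ((p i / (q k + s * p i) : ℝ) : ℂ) with hC
  refine ⟨F * C * Uᴴ, ?_⟩
  have e1 : (U * diagonal (fun i => (p i : ℂ)) * Uᴴ * (F * C * Uᴴ)).trace
      = (diagonal (fun i => (p i : ℂ)) * T * C).trace := by
    calc _ = (U * (diagonal (fun i => (p i : ℂ)) * (Uᴴ * F) * C * Uᴴ)).trace := by
          simp only [Matrix.mul_assoc]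
      _ = (diagonal (fun i => (p i : ℂ)) * (Uᴴ * F) * C * (Uᴴ * U)).trace := by
          rw [Matrix.trace_mul_comm]; simp only [Matrix.mul_assoc]
      _ = _ := by rw [hU, Matrix.mul_one]
  have e2 : ((F * C * Uᴴ)ᴴ * (F * diagonal (fun i => (q i : ℂ)) * Fᴴ) * (F * C * Uᴴ)).trace
      = (Cᴴ * diagonal (fun i => (q i : ℂ)) * C).trace := by
    calc _ = (U * (Cᴴ * (Fᴴ * F) * diagonal (fun i => (q i : ℂ)) * (Fᴴ * F) * C * Uᴴ)).trace := by
          simp only [conjTranspose_mul, conjTranspose_conjTranspose, Matrix.mul_assoc]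
      _ = (Cᴴ * diagonal (fun i => (q i : ℂ)) * C * (Uᴴ * U)).trace := by
          rw [Matrix.trace_mul_comm, hF]; simp only [Matrix.mul_assoc, Matrix.one_mul]
      _ = _ := by rw [hU, Matrix.mul_one]
  have e3 : ((F * C * Uᴴ) * (U * diagonal (fun i => (p i : ℂ)) * Uᴴ) * (F * C * Uᴴ)ᴴ).trace
      = (C * diagonal (fun i => (p i : ℂ)) * Cᴴ).trace := by
    calc _ = (F * (C * (Uᴴ * U) * diagonal (fun i => (p i : ℂ)) * (Uᴴ * U) * Cᴴ * Fᴴ)).trace := by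
          simp only [conjTranspose_mul, conjTranspose_conjTranspose, Matrix.mul_assoc]
      _ = (C * diagonal (fun i => (p i : ℂ)) * Cᴴ * (Fᴴ * F)).trace := by
          rw [Matrix.trace_mul_comm, hU]; simp only [Matrix.mul_assoc, Matrix.one_mul]
      _ = _ := by rw [hF, Matrix.mul_one]
  rw [e1, e2, e3]
  have f1 : (diagonal (fun i => (p i : ℂ)) * T * C).trace.re
      = ∑ i, ∑ k, p i * (Complex.normSq (T i k) * (p i / (q k + s * p i))) := by
    simp only [Matrix.trace, Matrix.diag, Matrix.mul_apply (N := C), diagonal_mul, Complex.re_sum]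
    refine Finset.sum_congr rfl fun i _ => Finset.sum_congr rfl fun k _ => ?_
    rw [mul_assoc, Complex.re_ofReal_mul]
    simp only [hC, Complex.star_def]
    rw [← mul_assoc, Complex.mul_conj, ← Complex.ofReal_mul, Complex.ofReal_re]
  have hCn : ∀ k i, Complex.normSq (C k i)
      = Complex.normSq (T i k) * (p i / (q k + s * p i)) ^ 2 := by
    intro k i
    simp only [hC, Complex.normSq_mul, Complex.star_def, Complex.normSq_conj,
      Complex.normSq_ofReal]
    ring
  have f2 : (Cᴴ * diagonal (fun i => (q i : ℂ)) * C).trace.re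
      = ∑ i, ∑ k, q k * Complex.normSq (C k i) := by
    simp only [Matrix.trace, Matrix.diag, Matrix.mul_apply (N := C), mul_diagonal, Complex.re_sum]
    refine Finset.sum_congr rfl fun i _ => Finset.sum_congr rfl fun k _ => ?_
    rw [mul_comm (Cᴴ i k), mul_assoc, Complex.re_ofReal_mul, conjTranspose_apply,
      Complex.star_def, ← Complex.normSq_eq_conj_mul_self, Complex.ofReal_re]
  have f3 : (C * diagonal (fun i => (p i : ℂ)) * Cᴴ).trace.re
      = ∑ i, ∑ k, p i * Complex.normSq (C k i) := by
    rw [Finset.sum_comm]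
    simp only [Matrix.trace, Matrix.diag, Matrix.mul_apply (N := Cᴴ), mul_diagonal, Complex.re_sum]
    refine Finset.sum_congr rfl fun i _ => Finset.sum_congr rfl fun k _ => ?_
    rw [mul_comm (C i k), mul_assoc, Complex.re_ofReal_mul, conjTranspose_apply,
      Complex.star_def, Complex.mul_conj, Complex.ofReal_re]
  rw [f1, f2, f3]
  simp only [Finset.mul_sum, ← Finset.sum_sub_distrib, hCn]
  refine Finset.sum_congr rfl fun i _ => Finset.sum_congr rfl fun k _ => ?_
  rcases (hp i).eq_or_lt with h0 | h0
  · simp [← h0]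
  · have h1 := hq k
    have : q k + s * p i ≠ 0 := by positivity
    field_simp
    ring

open Matrix in
lemma aux_mono {a b : Type*} [Fintype a] [Fintype b] [DecidableEq a] [DecidableEq b]
    (ρ : Matrix (a × b) (a × b) ℂ) 
    (ψ : ((a × b) × (a × b)) → ℂ) (hn : ∑ x, Complex.normSq (ψ x) = 1)
    (hpur : ∀ p q : a × b, ∑ r : a × b, ψ (p, r) * star (ψ (q, r)) = ρ p q)
    (M : Matrix (a × a) (b × b) ℂ)
    (hM : M = Matrix.of fun x y => ψ ((x.1, y.1), (x.2, y.2)))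
    (Y : Matrix (a × b) (a × b) ℂ) :
    ∃ X : Matrix (a × a) (b × b) ℂ,
      (Mᴴ * X).trace = (ρ * Y).trace ∧
      (Xᴴ * X).trace = (Y * ρ * Yᴴ).trace ∧
      ((Mᴴ * X * Mᴴ)ᴴ * (Mᴴ * X * Mᴴ)).trace.re
        ≤ (Yᴴ * (ptraceB ρ ⊗ₖ ptraceA ρ) * Y).trace.re := by
  set P : Matrix (a × b) (a × b) ℂ := Matrix.of fun p r => ψ (p, r) with hP
  have hρ : ρ = P * Pᴴ := by
    ext p q
    rw [← hpur]
    simp [hP, Matrix.mul_apply]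
  set R : Matrix (a × b) (a × b) ℂ → Matrix (a × a) (b × b) ℂ :=
    fun Z => Matrix.of fun x y => Z (x.1, y.1) (x.2, y.2) with hR
  have hRtr : ∀ Z Z', ((R Z)ᴴ * R Z').trace = (Zᴴ * Z').trace := by
    intro Z Z'
    simp only [hR, Matrix.trace, Matrix.diag, Matrix.mul_apply, conjTranspose_apply, of_apply]
    rw [← Fintype.sum_prod_type', ← Fintype.sum_prod_type']
    exact Fintype.sum_equiv ⟨fun t : (b × b) × (a × a) => ((t.2.2, t.1.2), (t.2.1, t.1.1)),
      fun u => ((u.2.2, u.1.2), (u.2.1, u.1.1)), fun _ => rfl, fun _ => rfl⟩ _ _ fun t => rfl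
  have hMR : M = R P := by rw [hM]; rfl
  refine ⟨R (Y * P), ?_, ?_, ?_⟩
  · rw [hMR, hRtr, hρ, Matrix.trace_mul_comm, Matrix.mul_assoc, Matrix.trace_mul_comm,
      Matrix.mul_assoc]
  · rw [hRtr, hρ, Matrix.trace_mul_comm, conjTranspose_mul]
    simp only [Matrix.mul_assoc]
  · set K : Matrix (a × b) ((b × (a × b)) × (a × (a × b))) ℂ :=
      Matrix.of fun i u => ψ ((i.1, u.1.1), u.1.2) * ψ ((u.2.1, i.2), u.2.2) with hK
    have hKK : ptraceB ρ ⊗ₖ ptraceA ρ = K * Kᴴ := by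
      ext ⟨i, j⟩ ⟨i', j'⟩
      simp only [kroneckerMap_apply, ptraceA, ptraceB, of_apply, ← hpur, Matrix.mul_apply,
        conjTranspose_apply, hK, star_mul']
      rw [← Fintype.sum_prod_type', ← Fintype.sum_prod_type', Finset.sum_mul_sum,
        ← Fintype.sum_prod_type']
      refine Finset.sum_congr rfl fun u _ => ?_
      ring
    have h1 : Yᴴ * (ptraceB ρ ⊗ₖ ptraceA ρ) * Y = (Kᴴ * Y)ᴴ * (Kᴴ * Y) := by
      rw [hKK]; simp only [conjTranspose_mul, conjTranspose_conjTranspose, Matrix.mul_assoc]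
    rw [h1, aux_tr_normSq, aux_tr_normSq]
    have hent : ∀ (y : b × b) (x : a × a), (Mᴴ * R (Y * P) * Mᴴ) y x =
        ∑ z : (a × b) × (a × b), ψ z * (Kᴴ * Y) ((y.1, (z.2.1, y.2)), (x.1, (x.2, z.2.2))) z.1 := by
      intro y x
      simp only [Matrix.mul_apply, conjTranspose_apply, hMR, hR, hK, hP, of_apply,
        Finset.mul_sum, Finset.sum_mul, star_mul']
      rw [← Fintype.sum_prod_type', ← Fintype.sum_prod_type', ← Fintype.sum_prod_type']
      refine Fintype.sum_equiv ⟨fun t : ((b × b) × (a × a)) × (a × b) =>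
        ((t.2, (t.1.2.2, t.1.1.2)), (t.1.2.1, t.1.1.1)),
        fun u => (((u.2.2, u.1.2.2), (u.2.1, u.1.2.1)), u.1.1), fun _ => rfl, fun _ => rfl⟩
        _ _ fun t => ?_
      simp only [Equiv.coe_fn_mk]
      ring
    generalize Kᴴ * Y = G at *
    calc _ ≤ ∑ y : b × b, ∑ x : a × a, ∑ z : (a × b) × (a × b),
          Complex.normSq (G ((y.1, (z.2.1, y.2)), (x.1, (x.2, z.2.2))) z.1) := by
          refine Finset.sum_le_sum fun y _ => Finset.sum_le_sum fun x _ => ?_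
          rw [hent]
          refine (aux_cauchy _ _).trans ?_
          rw [hn, one_mul]
      _ = _ := by
          rw [← Fintype.sum_prod_type', ← Fintype.sum_prod_type', ← Fintype.sum_prod_type']
          refine Fintype.sum_equiv ⟨fun t : ((b × b) × (a × a)) × ((a × b) × (a × b)) =>
            (((t.1.1.1, (t.2.2.1, t.1.1.2)),
            (t.1.2.1, (t.1.2.2, t.2.2.2))), t.2.1), fun u =>
            (((u.1.1.1, u.1.1.2.2), (u.1.2.1, u.1.2.2.1)), (u.2, (u.1.1.2.1, u.1.2.2.2))),
            fun _ => rfl, fun _ => rfl⟩ _ _ fun t => ?_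
          rfl

open Matrix in
lemma aux_margA {a b : Type*} [Fintype a] [Fintype b] [DecidableEq a] [DecidableEq b]
    (ρ : Matrix (a × b) (a × b) ℂ) (V : Matrix a a ℂ) (Z : Matrix b b ℂ) (hZ : Z * Zᴴ = 1)
    (j : a) :
    ∑ k, ((V ⊗ₖ Z)ᴴ * ρ * (V ⊗ₖ Z)) (j, k) (j, k) = (Vᴴ * ptraceB ρ * V) j j := by
  have hz : ∀ y y', ∑ k, Z y' k * star (Z y k) = if y' = y then 1 else 0 := by
    intro y y'
    have := congrFun (congrFun hZ y') y
    simpa [Matrix.mul_apply, Matrix.one_apply] using this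
  simp only [Matrix.mul_apply, conjTranspose_apply, kroneckerMap_apply, ptraceB, of_apply,
    Finset.sum_mul, Finset.mul_sum, star_mul']
  calc _ = ∑ x' : a × b, ∑ x : a × b, star (V x.1 j) * ρ x x' * V x'.1 j *
        ∑ k, Z x'.2 k * star (Z x.2 k) := by
        rw [Finset.sum_comm]
        refine Finset.sum_congr rfl fun x' _ => ?_
        rw [Finset.sum_comm]
        refine Finset.sum_congr rfl fun x _ => ?_
        rw [Finset.mul_sum]
        refine Finset.sum_congr rfl fun k _ => ?_
        ring
    _ = _ := by
        simp only [hz, mul_ite, mul_one, mul_zero, Fintype.sum_prod_type, Finset.sum_ite_eq,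
          Finset.mem_univ, if_true]
        refine Finset.sum_congr rfl fun x' _ => ?_
        rw [Finset.sum_comm]

open Matrix in
lemma aux_margB {a b : Type*} [Fintype a] [Fintype b] [DecidableEq a] [DecidableEq b]
    (ρ : Matrix (a × b) (a × b) ℂ) (V : Matrix a a ℂ) (Z : Matrix b b ℂ) (hV : V * Vᴴ = 1)
    (k : b) :
    ∑ j, ((V ⊗ₖ Z)ᴴ * ρ * (V ⊗ₖ Z)) (j, k) (j, k) = (Zᴴ * ptraceA ρ * Z) k k := by
  have hz : ∀ y y', ∑ k, V y' k * star (V y k) = if y' = y then 1 else 0 := by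
    intro y y'
    have := congrFun (congrFun hV y') y
    simpa [Matrix.mul_apply, Matrix.one_apply] using this
  simp only [Matrix.mul_apply, conjTranspose_apply, kroneckerMap_apply, ptraceA, of_apply,
    Finset.sum_mul, Finset.mul_sum, star_mul']
  calc _ = ∑ x' : a × b, ∑ x : a × b, star (Z x.2 k) * ρ x x' * Z x'.2 k *
        ∑ k, V x'.1 k * star (V x.1 k) := by
        rw [Finset.sum_comm]
        refine Finset.sum_congr rfl fun x' _ => ?_
        rw [Finset.sum_comm]
        refine Finset.sum_congr rfl fun x _ => ?_
        rw [Finset.mul_sum]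
        refine Finset.sum_congr rfl fun k _ => ?_
        ring
    _ = _ := by
        simp only [hz, mul_ite, mul_one, mul_zero, Fintype.sum_prod_type_right, Finset.sum_ite_eq,
          Finset.mem_univ, if_true]
        refine Finset.sum_congr rfl fun x' _ => ?_
        rw [Finset.sum_comm]

open Matrix in
lemma aux_spec {m : Type*} [Fintype m] [DecidableEq m] (σ : Matrix m m ℂ)
    (h : σ.IsHermitian) : ∃ E : Matrix m m ℂ, Eᴴ * E = 1 ∧ E * Eᴴ = 1 ∧
      σ = E * diagonal (fun i => (h.eigenvalues i : ℂ)) * Eᴴ := by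
  refine ⟨h.eigenvectorUnitary, Matrix.mem_unitaryGroup_iff'.mp (h.eigenvectorUnitary).2,
    Matrix.mem_unitaryGroup_iff.mp (h.eigenvectorUnitary).2, ?_⟩
  have := h.spectral_theorem
  rw [Unitary.conjStarAlgAut_apply] at this
  exact this

open Matrix in
lemma aux_psdB {a b : Type*} [Fintype a] [Fintype b] [DecidableEq a] [DecidableEq b]
    (ρ : Matrix (a × b) (a × b) ℂ) (h : ρ.PosSemidef) : (ptraceB ρ).PosSemidef := by
  have : ptraceB ρ = ∑ j : b, ρ.submatrix (fun i => (i, j)) (fun i => (i, j)) := by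
    ext i i'
    simp [ptraceB, Matrix.sum_apply]
  rw [this]
  exact Matrix.posSemidef_sum _ fun j _ => h.submatrix _

open Matrix in
lemma aux_psdA {a b : Type*} [Fintype a] [Fintype b] [DecidableEq a] [DecidableEq b]
    (ρ : Matrix (a × b) (a × b) ℂ) (h : ρ.PosSemidef) : (ptraceA ρ).PosSemidef := by
  have : ptraceA ρ = ∑ j : a, ρ.submatrix (fun i => (j, i)) (fun i => (j, i)) := by
    ext i i'
    simp [ptraceA, Matrix.sum_apply]
  rw [this]
  exact Matrix.posSemidef_sum _ fun j _ => h.submatrix _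

/-- Mutual information bounded by twice the entanglement entropy of any
purification: if `|TFD⟩ = ψ` on `(H_A ⊗ H_B) ⊗ (H_A ⊗ H_B)` purifies `ρ`
(partial trace over the second copy gives `ρ`), and `σ` is the reduced state of
`|TFD⟩⟨TFD|` on the two copies of `A`, then `I_ρ(A:B) ≤ 2·S(σ)`. -/
theorem stmt_14 {a b : Type*} [Fintype a] [Fintype b] [DecidableEq a] [DecidableEq b]
    (ρ : Matrix (a × b) (a × b) ℂ) (hρ : IsDensityMatrix ρ)
    (ψ : ((a × b) × (a × b)) → ℂ)
    (hpur : ∀ p q : a × b, ∑ r : a × b, ψ (p, r) * star (ψ (q, r)) = ρ p q)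
    (σ : Matrix (a × a) (a × a) ℂ)
    (hσ : σ = Matrix.of fun x y : a × a =>
      ∑ bL : b, ∑ bR : b,
        ψ ((x.1, bL), (x.2, bR)) * star (ψ ((y.1, bL), (y.2, bR)))) :
    mutualInfo ρ ≤ 2 * vnEntropy σ := by
  classical
  obtain ⟨hpsd, htr⟩ := hρ
  have hA := aux_psdB ρ hpsd
  have hB := aux_psdA ρ hpsd
  obtain ⟨M, hM⟩ : ∃ M : Matrix (a × a) (b × b) ℂ,
    M = Matrix.of fun x y => ψ ((x.1, y.1), (x.2, y.2)) := ⟨_, rfl⟩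
  have hσM : σ = M * M.conjTranspose := by
    ext x y
    simp only [hσ, hM, Matrix.mul_apply, Matrix.conjTranspose_apply, Matrix.of_apply,
      Fintype.sum_prod_type]
  have hσpsd : σ.PosSemidef := by
    rw [hσM]; exact Matrix.posSemidef_self_mul_conjTranspose M
  have hn : ∑ x, Complex.normSq (ψ x) = 1 := by
    have h1 : ((∑ x, Complex.normSq (ψ x) : ℝ) : ℂ) = 1 := by
      rw [← htr, Fintype.sum_prod_type]
      simp only [Matrix.trace, Matrix.diag, ← hpur, Complex.star_def, Complex.mul_conj]
      push_cast
      rfl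
    exact_mod_cast h1
  have hσtr : ∑ m, hσpsd.1.eigenvalues m = 1 := by
    have h1 : σ.trace = 1 := by
      have h2 : (∑ x, Complex.normSq (ψ x) : ℝ) = ((M.conjTranspose * M).trace).re := by
        rw [aux_tr_normSq, hM, ← Fintype.sum_prod_type']
        exact Fintype.sum_equiv ⟨fun t : (a × b) × (a × b) => ((t.1.1, t.2.1), (t.1.2, t.2.2)),
          fun t => ((t.1.1, t.2.1), (t.1.2, t.2.2)), fun _ => rfl, fun _ => rfl⟩ _ _ fun t => rfl
      rw [Matrix.trace_mul_comm, ← hσM, hn] at h2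
      apply Complex.ext
      · simpa using h2.symm
      · have := hσpsd.1.trace_eq_sum_eigenvalues
        rw [this]; simp
    have h2 := hσpsd.1.trace_eq_sum_eigenvalues
    rw [h1] at h2
    have h3 := congrArg Complex.re h2
    simpa using h3.symm
  obtain ⟨U, hU, hU', hρU⟩ := aux_spec ρ hpsd.1
  obtain ⟨V, hV, hV', hAV⟩ := aux_spec _ hA.1
  obtain ⟨Z, hZ, hZ', hBZ⟩ := aux_spec _ hB.1
  have hp0 := hpsd.eigenvalues_nonneg
  have hα0 := hA.eigenvalues_nonneg
  have hβ0 := hB.eigenvalues_nonneg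
  unfold mutualInfo vnEntropy
  rw [dif_pos hpsd.1, dif_pos hA.1, dif_pos hB.1, dif_pos hσpsd.1]
  have hres := aux_resolvent σ hσpsd.1
  generalize hσpsd.1.eigenvalues = l at *
  generalize hpsd.1.eigenvalues = p at *
  generalize hA.1.eigenvalues = α at *
  generalize hB.1.eigenvalues = β at *
  obtain ⟨F, hFdef⟩ : ∃ F, F = Matrix.kroneckerMap (· * ·) V Z := ⟨_, rfl⟩
  have hF : F.conjTranspose * F = 1 := by
    rw [hFdef, Matrix.conjTranspose_kronecker, ← Matrix.mul_kronecker_mul, hV, hZ,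
      Matrix.one_kronecker_one]
  have hF' : F * F.conjTranspose = 1 := by
    rw [hFdef, Matrix.conjTranspose_kronecker, ← Matrix.mul_kronecker_mul, hV', hZ',
      Matrix.one_kronecker_one]
  have hτ : Matrix.kroneckerMap (· * ·) (ptraceB ρ) (ptraceA ρ)
      = F * Matrix.diagonal (fun x : a × b => ((α x.1 * β x.2 : ℝ) : ℂ)) * F.conjTranspose := by
    have hdd : Matrix.diagonal (fun x : a × b => ((α x.1 * β x.2 : ℝ) : ℂ))
        = Matrix.kroneckerMap (· * ·) (Matrix.diagonal (fun i => (α i : ℂ)))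
          (Matrix.diagonal (fun i => (β i : ℂ))) := by
      rw [Matrix.diagonal_kronecker_diagonal]
      simp
    rw [hdd, hFdef, Matrix.conjTranspose_kronecker, ← Matrix.mul_kronecker_mul,
      ← Matrix.mul_kronecker_mul, ← hAV, ← hBZ]
  obtain ⟨T, hT⟩ : ∃ T, T = U.conjTranspose * F := ⟨_, rfl⟩
  obtain ⟨w, hw⟩ : ∃ w : (a × b) → (a × b) → ℝ,
    w = fun i k => p i * Complex.normSq (T i k) := ⟨_, rfl⟩
  have hw0 : ∀ i k, 0 ≤ w i k := by
    intro i k; rw [hw]; exact mul_nonneg (hp0 i) (Complex.normSq_nonneg _)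
  -- marginals
  have hwp : ∀ i, ∑ k, w i k = p i := by
    intro i
    have h1 : T * T.conjTranspose = 1 := by
      rw [hT, Matrix.conjTranspose_mul, Matrix.conjTranspose_conjTranspose, Matrix.mul_assoc,
        ← Matrix.mul_assoc F, hF', Matrix.one_mul, hU]
    have h2 := congrFun (congrFun h1 i) i
    simp only [Matrix.mul_apply, Matrix.conjTranspose_apply, Complex.star_def, Complex.mul_conj,
      Matrix.one_apply_eq] at h2
    have h3 : ∑ k, Complex.normSq (T i k) = 1 := by exact_mod_cast h2
    rw [hw]
    simp only [← Finset.mul_sum, h3, mul_one]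
  have hwF : ∀ k, ((∑ i, w i k : ℝ) : ℂ) = (F.conjTranspose * ρ * F) k k := by
    intro k
    have h1 : F.conjTranspose * ρ * F
        = T.conjTranspose * Matrix.diagonal (fun i => (p i : ℂ)) * T := by
      rw [hρU, hT, Matrix.conjTranspose_mul, Matrix.conjTranspose_conjTranspose]
      simp only [Matrix.mul_assoc]
    rw [h1, Matrix.mul_apply]
    simp only [Matrix.mul_diagonal, Matrix.conjTranspose_apply, hw]
    push_cast
    refine Finset.sum_congr rfl fun i _ => ?_
    rw [Complex.normSq_eq_conj_mul_self, Complex.star_def]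
    ring
  have hwα : ∀ j, ∑ k, ∑ i, w i (j, k) = α j := by
    intro j
    have h1 := aux_margA ρ V Z hZ' j
    rw [← hFdef] at h1
    simp only [← hwF] at h1
    have h2 : V.conjTranspose * ptraceB ρ * V = Matrix.diagonal (fun i => (α i : ℂ)) := by
      rw [hAV]
      calc _ = (V.conjTranspose * V) * Matrix.diagonal (fun i => (α i : ℂ))
            * (V.conjTranspose * V) := by simp only [Matrix.mul_assoc]
        _ = _ := by rw [hV, Matrix.one_mul, Matrix.mul_one]
    rw [h2, Matrix.diagonal_apply_eq] at h1
    exact_mod_cast h1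
  have hwβ : ∀ k, ∑ j, ∑ i, w i (j, k) = β k := by
    intro j
    have h1 := aux_margB ρ V Z hV' j
    rw [← hFdef] at h1
    simp only [← hwF] at h1
    have h2 : Z.conjTranspose * ptraceA ρ * Z = Matrix.diagonal (fun i => (β i : ℂ)) := by
      rw [hBZ]
      calc _ = (Z.conjTranspose * Z) * Matrix.diagonal (fun i => (β i : ℂ))
            * (Z.conjTranspose * Z) := by simp only [Matrix.mul_assoc]
        _ = _ := by rw [hZ, Matrix.one_mul, Matrix.mul_one]
    rw [h2, Matrix.diagonal_apply_eq] at h1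
    exact_mod_cast h1
  have hsp : ∀ i j k, w i (j, k) ≠ 0 → p i ≠ 0 ∧ α j ≠ 0 ∧ β k ≠ 0 := by
    intro i j k h
    have hpos : 0 < w i (j, k) := lt_of_le_of_ne (hw0 _ _) (Ne.symm h)
    have h1 : w i (j, k) ≤ ∑ i, w i (j, k) :=
      Finset.single_le_sum (f := fun i => w i (j, k)) (fun _ _ => hw0 _ _) (Finset.mem_univ i)
    refine ⟨?_, ?_, ?_⟩
    · intro h0; apply h; rw [hw]; simp [h0]
    · have h2 : ∑ i, w i (j, k) ≤ α j := by
        rw [← hwα j]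
        exact Finset.single_le_sum (f := fun k => ∑ i, w i (j, k))
          (fun _ _ => Finset.sum_nonneg fun _ _ => hw0 _ _) (Finset.mem_univ k)
      linarith
    · have h2 : ∑ i, w i (j, k) ≤ β k := by
        rw [← hwβ k]
        exact Finset.single_le_sum (f := fun j => ∑ i, w i (j, k))
          (fun _ _ => Finset.sum_nonneg fun _ _ => hw0 _ _) (Finset.mem_univ j)
      linarith
  have hsump : ∑ i, p i = 1 := by
    have h1 : ρ.trace = ∑ i, (p i : ℂ) := by
      rw [hρU, Matrix.trace_mul_comm, ← Matrix.mul_assoc, hU, Matrix.one_mul,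
        Matrix.trace_diagonal]
    rw [htr] at h1
    exact_mod_cast h1.symm
  have main := aux_scalar (fun x : (a × b) × (a × b) => w x.1 x.2)
    (fun x => α x.2.1 * β x.2.2 / p x.1) l
    (fun x => div_nonneg (mul_nonneg (hα0 _) (hβ0 _)) (hp0 _))
    (fun x hx => by
      obtain ⟨h1, h2, h3⟩ := hsp x.1 x.2.1 x.2.2 hx
      exact div_ne_zero (mul_ne_zero h2 h3) h1)
    (by rw [Fintype.sum_prod_type]; simp only [hwp]; rw [hsump, hσtr])
    (by
      intro s hs
      obtain ⟨W, hW1, hW2, hW3⟩ := hres s hs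
      obtain ⟨Y, hY⟩ := aux_opt U F hU hF p (fun x : a × b => α x.1 * β x.2) hp0
        (fun x => mul_nonneg (hα0 _) (hβ0 _)) s hs
      obtain ⟨X, hX1, hX2, hX3⟩ := aux_mono ρ ψ hn hpur M hM Y
      have hsq := aux_square M X W hW1 s hs (by rw [← hσM]; exact hW2)
      rw [← hσM, hW3, hX1, hX2] at hsq
      rw [← hρU, ← hτ] at hY
      have hle : ∑ x : (a × b) × (a × b), w x.1 x.2 / (α x.2.1 * β x.2.2 / p x.1 + s)
          = ∑ i, ∑ k : a × b, p i ^ 2 * Complex.normSq ((U.conjTranspose * F) i k)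
            / (α k.1 * β k.2 + s * p i) := by
        rw [Fintype.sum_prod_type]
        refine Finset.sum_congr rfl fun i _ => Finset.sum_congr rfl fun k _ => ?_
        rw [hw, ← hT]
        rcases (hp0 i).eq_or_lt with h0 | h0
        · have h0' : p i = 0 := h0.symm
          simp [h0']
        · have h0' : 0 < p i := h0
          have h1 : 0 ≤ α k.1 * β k.2 := mul_nonneg (hα0 _) (hβ0 _)
          have h2 : α k.1 * β k.2 + s * p i ≠ 0 := by positivity
          have h3 : α k.1 * β k.2 / p i + s = (α k.1 * β k.2 + s * p i) / p i := by
            field_simp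
          simp only
          rw [h3]
          field_simp
      rw [hle, ← hY]
      linarith)
  have hlog : ∑ x : (a × b) × (a × b), w x.1 x.2 * Real.log (α x.2.1 * β x.2.2 / p x.1)
      = ∑ j, α j * Real.log (α j) + ∑ k, β k * Real.log (β k) - ∑ i, p i * Real.log (p i) := by
    have h1 : ∀ x : (a × b) × (a × b), w x.1 x.2 * Real.log (α x.2.1 * β x.2.2 / p x.1)
        = w x.1 x.2 * Real.log (α x.2.1) + w x.1 x.2 * Real.log (β x.2.2)
          - w x.1 x.2 * Real.log (p x.1) := by
      intro x
      by_cases h : w x.1 x.2 = 0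
      · simp [h]
      · obtain ⟨h1, h2, h3⟩ := hsp x.1 x.2.1 x.2.2 h
        rw [Real.log_div (mul_ne_zero h2 h3) h1, Real.log_mul h2 h3]
        ring
    simp only [h1, Finset.sum_sub_distrib, Finset.sum_add_distrib]
    congr 1
    · congr 1
      · rw [Fintype.sum_prod_type_right, Fintype.sum_prod_type]
        refine Finset.sum_congr rfl fun j _ => ?_
        simp only [← Finset.sum_mul, hwα]
      · rw [Fintype.sum_prod_type_right, Fintype.sum_prod_type_right]
        refine Finset.sum_congr rfl fun j _ => ?_
        simp only [← Finset.sum_mul, hwβ]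
    · rw [Fintype.sum_prod_type]
      refine Finset.sum_congr rfl fun j _ => ?_
      simp only [← Finset.sum_mul, hwp]
  simp only [hlog, Real.log_pow] at main
  have hl2 : ∑ m, l m * ((2 : ℕ) * Real.log (l m)) = 2 * ∑ m, l m * Real.log (l m) := by
    rw [Finset.mul_sum]
    refine Finset.sum_congr rfl fun m _ => ?_
    push_cast; ring
  rw [hl2] at main
  linarith
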